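/- (Second intertwiner-like identity, affine case.) Write Q = q − q⁻¹ and U_j⁺ = Y_j/(u−Y_j). In the ring of formal Laurent series in u⁻¹ with coefficients in W_k, for every 1 ≤ i ≤ k−1: ( U_{i+1}⁺ + T_i/Q − E_i·Y_iY_{i+1}/(u²−Y_iY_{i+1}) ) − Q²(U_i⁺ + 1)( U_{i+1}⁺ + T_i/Q − E_i·Y_iY_{i+1}/(u²−Y_iY_{i+1}) )U_i⁺ = ( T_iU_i⁺T_i⁻¹ + T_i/Q − E_i·Y_iY_{i+1}/(u²−Y_iY_{i+1}) ) − Q² U_{i+1}⁺( E_iU_i⁺E_i + z·E_i/Q − E_i·Y_iY_{i+1}/(u²−Y_iY_{i+1}) )(U_{i+1}⁺ + 1). -/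

import Mathlib

/-- A `C`-algebra `A` together with elements satisfying the defining relations of the
affine BMW algebra `W_k` with parameters `q, z ∈ Cˣ` and `Z₀⁽ℓ⁾ ∈ C` (`ℓ ∈ ℤ`).
Indexing is 0-based: the paper's `T_i, E_i` (for `1 ≤ i ≤ k-1`) are `T (i-1) _, E (i-1) _`
here, and the paper's `Y_i` (for `1 ≤ i ≤ k`) is `Y (i-1)`.  The fields `Y_zero`, `Y_succ`
say `Y₁ = z X^{ε₁}`, `Y_{i+1} = T_i Y_i T_i`, and `E_def` is the equation
`T_i Y_i = Y_{i+1} T_i - (q - q⁻¹) Y_{i+1} (1 - E_i)` defining `E_i`. -/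
structure AffBMW (C : Type*) [CommRing C] (k : ℕ) (q z : Cˣ) (Z₀ : ℤ → C)
    (A : Type*) [Ring A] [Algebra C A] where
  T : ∀ i : ℕ, i + 1 < k → A
  Tinv : ∀ i : ℕ, i + 1 < k → A
  X : A
  E : ∀ i : ℕ, i + 1 < k → A
  Y : ℕ → A
  Yinv : ℕ → A
  T_Tinv : ∀ i (h : i + 1 < k), T i h * Tinv i h = 1
  Tinv_T : ∀ i (h : i + 1 < k), Tinv i h * T i h = 1
  braid_far : ∀ i j (hi : i + 1 < k) (hj : j + 1 < k), i + 2 ≤ j →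
      T i hi * T j hj = T j hj * T i hi
  braid : ∀ i (h : i + 2 < k),
      T i (by omega) * T (i + 1) h * T i (by omega) =
        T (i + 1) h * T i (by omega) * T (i + 1) h
  XTXT : ∀ h : 1 < k, X * T 0 h * X * T 0 h = T 0 h * X * T 0 h * X
  X_T : ∀ i (h : i + 1 < k), 1 ≤ i → X * T i h = T i h * X
  Y_zero : Y 0 = (z : C) • X
  Y_succ : ∀ i (h : i + 1 < k), Y (i + 1) = T i h * Y i * T i h
  Y_Yinv : ∀ i, i < k → Y i * Yinv i = 1
  Yinv_Y : ∀ i, i < k → Yinv i * Y i = 1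
  E_def : ∀ i (h : i + 1 < k),
      T i h * Y i =
        Y (i + 1) * T i h -
          ((q : C) - ((q⁻¹ : Cˣ) : C)) • (Y (i + 1) * (1 - E i h))
  E_T : ∀ i (h : i + 1 < k), E i h * T i h = ((z⁻¹ : Cˣ) : C) • E i h
  T_E : ∀ i (h : i + 1 < k), T i h * E i h = ((z⁻¹ : Cˣ) : C) • E i h
  E_Tinv : ∀ i (h : i + 1 < k), E i h * Tinv i h = (z : C) • E i h
  Tinv_E : ∀ i (h : i + 1 < k), Tinv i h * E i h = (z : C) • E i h
  ETE_up : ∀ i (h : i + 1 < k) (h' : i + 2 < k),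
      E i h * T (i + 1) h' * E i h = (z : C) • E i h
  ETinvE_up : ∀ i (h : i + 1 < k) (h' : i + 2 < k),
      E i h * Tinv (i + 1) h' * E i h = ((z⁻¹ : Cˣ) : C) • E i h
  ETE_down : ∀ i (h : i + 1 < k) (h' : i - 1 + 1 < k), 1 ≤ i →
      E i h * T (i - 1) h' * E i h = (z : C) • E i h
  ETinvE_down : ∀ i (h : i + 1 < k) (h' : i - 1 + 1 < k), 1 ≤ i →
      E i h * Tinv (i - 1) h' * E i h = ((z⁻¹ : Cˣ) : C) • E i h
  EYE : ∀ (h : 1 < k) (ℓ : ℤ),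
      E 0 h * (if 0 ≤ ℓ then Y 0 ^ ℓ.toNat else Yinv 0 ^ (-ℓ).toNat) * E 0 h =
        Z₀ ℓ • E 0 h
  E_YY : ∀ i (h : i + 1 < k), E i h * (Y i * Y (i + 1)) = E i h
  YY_E : ∀ i (h : i + 1 < k), (Y i * Y (i + 1)) * E i h = E i h

noncomputable section

/-- `a/(u - a) := Σ_{ℓ≥1} a^ℓ u^{-ℓ}`, a formal Laurent series in `u⁻¹`
(an element of `LaurentSeries A = HahnSeries ℤ A` whose variable is `u⁻¹`). -/
def geomU {A : Type*} [Ring A] (a : A) : LaurentSeries A :=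
  HahnSeries.ofPowerSeries ℤ A (PowerSeries.mk fun n => if n = 0 then 0 else a ^ n)

/-- `1/(u - a) := Σ_{ℓ≥1} a^{ℓ-1} u^{-ℓ}`. -/
def invU {A : Type*} [Ring A] (a : A) : LaurentSeries A :=
  HahnSeries.ofPowerSeries ℤ A (PowerSeries.mk fun n => if n = 0 then 0 else a ^ (n - 1))

/-- `a/(u² - a) := Σ_{ℓ≥1} a^ℓ u^{-2ℓ}`. -/
def geomU2 {A : Type*} [Ring A] (a : A) : LaurentSeries A :=
  HahnSeries.ofPowerSeries ℤ A
    (PowerSeries.mk fun n => if n = 0 then 0 else if n % 2 = 0 then a ^ (n / 2) else 0)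

/-- `1/(u² - a) := Σ_{ℓ≥1} a^{ℓ-1} u^{-2ℓ}`. -/
def invU2 {A : Type*} [Ring A] (a : A) : LaurentSeries A :=
  HahnSeries.ofPowerSeries ℤ A
    (PowerSeries.mk fun n => if n = 0 then 0 else if n % 2 = 0 then a ^ (n / 2 - 1) else 0)

/-- `u²/(u² - 1) := Σ_{m≥0} u^{-2m}`. -/
def selfU2 (A : Type*) [Ring A] : LaurentSeries A :=
  HahnSeries.ofPowerSeries ℤ A (PowerSeries.mk fun n => if n % 2 = 0 then 1 else 0)

/-- `1/(u² - 1) := Σ_{m≥1} u^{-2m}`. -/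
def invU2one (A : Type*) [Ring A] : LaurentSeries A :=
  HahnSeries.ofPowerSeries ℤ A
    (PowerSeries.mk fun n => if n = 0 then 0 else if n % 2 = 0 then 1 else 0)

/-- The variable `u` itself (the inverse of the Laurent series variable `u⁻¹`). -/
def Uvar (A : Type*) [Ring A] : LaurentSeries A := HahnSeries.single (-1 : ℤ) 1

/-- A constant Laurent series. -/
def cst {A : Type*} [Ring A] (a : A) : LaurentSeries A := HahnSeries.C a

end



section Abstract

variable {C R : Type*} [CommRing C] [Ring R] [Algebra C R]

/-- If `G = 1 + U` is inverse to `1 - s` and `H = 1 + V` is inverse to `1 - t`, a commutation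
relation `M s - t M = N` turns into `M U - V M = H N G`. -/
theorem resolvent_comm {s t U V M N : R} (hU : (1 - s) * (U + 1) = 1)
    (hV : (V + 1) * (1 - t) = 1) (hM : M * s - t * M = N) :
    M * U - V * M = (V + 1) * N * (U + 1) := by
  calc M * U - V * M = 1 * M * (U + 1) - (V + 1) * M * 1 := by noncomm_ring
    _ = ((V + 1) * (1 - t)) * M * (U + 1) - (V + 1) * M * ((1 - s) * (U + 1)) := by rw [hU, hV]
    _ = (V + 1) * (M * s - t * M) * (U + 1) := by
      simp only [mul_add, add_mul, mul_sub, sub_mul, mul_one, one_mul, mul_assoc]; abel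
    _ = _ := by rw [hM]

theorem eq_mul_of_eq_mul_add {y W P S : R} (hW : (W + 1) * (1 - y) = 1) (hP : P = y * (P + S)) :
    P = W * S := by
  have hP' : (1 - y) * P = y * S := by
    rw [sub_mul, one_mul, sub_eq_iff_eq_add, add_comm, ← mul_add]
    exact hP
  have hWy : (W + 1) * y = W := by
    rw [mul_one_sub, sub_eq_iff_eq_add] at hW
    exact (add_right_cancel ((add_comm _ _).trans hW.symm)).symm ▸ rfl
  calc P = (W + 1) * (1 - y) * P := by rw [hW, one_mul]
    _ = W * S := by rw [mul_assoc, hP', ← mul_assoc, hWy]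

/-- The resolvents `1 + U = (1 - s)⁻¹` and `1 + V = (1 - t)⁻¹` of commuting elements commute, and
their products `U * V` satisfy a two-sided fixed point equation. -/
theorem resolvent_mul_resolvent {s t U V : R} (hU : (1 - s) * (U + 1) = 1)
    (hU' : (U + 1) * (1 - s) = 1) (hV : (1 - t) * (V + 1) = 1) (hV' : (V + 1) * (1 - t) = 1)
    (hst : s * t = t * s) :
    U * V = V * U ∧ U * V = s * t * (U * V + (U + V + 1)) ∧
      U * V = (U * V + (U + V + 1)) * (s * t) := by
  have htU : t * U = U * t := by
    simpa [sub_eq_zero] using resolvent_comm (M := t) hU hU' (sub_eq_zero.2 hst.symm)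
  have hVU : U * V = V * U := by
    simpa [sub_eq_zero] using resolvent_comm (M := U) hV hV' (sub_eq_zero.2 htU.symm)
  have hsV : s * V = V * s := by
    simpa [sub_eq_zero] using resolvent_comm (M := s) hV hV' (sub_eq_zero.2 hst)
  have h1 : U = s * (U + 1) := by linear_combination (norm := noncomm_ring) hU
  have h2 : U = (U + 1) * s := by linear_combination (norm := noncomm_ring) hU'
  have h3 : V = t * (V + 1) := by linear_combination (norm := noncomm_ring) hV
  have h4 : V = (V + 1) * t := by linear_combination (norm := noncomm_ring) hV'
  refine ⟨hVU, ?_, ?_⟩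
  · linear_combination (norm := noncomm_ring) h1 * V + s * (U + 1) * h3 - s * htU * (V + 1)
  · linear_combination (norm := noncomm_ring) h2 * V + (U + 1) * s * h4 + (U + 1) * hsV * t

theorem intertwiner_of_skein {Q p z z' : C} (hp : p * Q = 1) {T T' E U V W : R}
    (hTT' : T * T' = 1) (hT : T * T = 1 + Q • T - (Q * z') • E)
    (hET : E * T = z' • E) (hz : z * z' = 1)
    (hEE : Q • (E * E) = (Q + z - z') • E)
    (hTU : T * U - V * T = -(Q • (V * (1 - E) * (U + 1))))
    (hTV : T * V - U * T = Q • ((U + 1) * (1 - E) * V))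
    (hUV : U * V = V * U) (hEUV : E * (U * V) = W * (E * (U + V + 1)))
    (hUVE : U * V * E = W * ((U + V + 1) * E)) (hW : ∀ x, W * x = x * W) :
    (V + p • T - W * E) - Q ^ 2 • ((U + 1) * (V + p • T - W * E) * U) =
      (T * U * T' + p • T - W * E) -
        Q ^ 2 • (V * (E * U * E + (z * p) • E - W * E) * (V + 1)) := by
  have hWV : ∀ x, V * (W * x) = W * (V * x) := fun x => by rw [← mul_assoc, ← hW, mul_assoc]
  have hWU : ∀ x, U * (W * x) = W * (U * x) := fun x => by rw [← mul_assoc, ← hW, mul_assoc]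
  -- the products of the bracket on the right-hand side with `V` and with `(V + 1) * T`
  have hEUT : E * U * T =
      Q • ((E * U * E + (z * p) • E - W * E) * V) - Q • (W * (E * (U + 1))) := by
    linear_combination (norm := skip) -(E * hTV) + hET * V + hEE * V - Q • hEUV -
      (z * hp) • (E * V)
    simp only [mul_add, add_mul, mul_sub, sub_mul, mul_one, one_mul, mul_assoc, smul_mul_assoc,
      mul_smul_comm]
    module
  have hPT : (E * U * E + (z * p) • E - W * E) * (V + 1) * T =
      p • (E * (U + 1)) + (1 + W) * (E * U * T) := by
    linear_combination (norm := skip) -(p • (hEUT * T)) + p • (E * U * hT) +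
      E * U * hET + (z * p) • hET - hp • ((E * U * E + (z * p) • E - W * E) * V * T) +
      hp • (W * (E * (U + 1)) * T) + hp • (E * U * T) - (z' * hp) • (E * U * E) + (hz * p) • E
    simp only [mul_add, add_mul, mul_sub, sub_mul, mul_one, one_mul, mul_assoc, smul_mul_assoc,
      mul_smul_comm]
    module
  have hSUT : (V + p • T - W * E) * U * T = p • V + (V - W) * (E * U * T) := by
    linear_combination (norm := skip) p • (hTU * T) + p • (V * hT) + V * hET -
      hp • (V * (1 - E) * (U + 1) * T) + hp • (V * T) - (z' * hp) • (V * E)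
    simp only [mul_add, add_mul, mul_sub, sub_mul, mul_one, mul_assoc, smul_mul_assoc,
      mul_smul_comm, neg_mul]
    module
  have hVE : (U + 1) * ((V - W) * E) = (1 + W) * (V * E) := by
    linear_combination (norm := skip) hUVE
    simp only [mul_add, add_mul, mul_sub, sub_mul, one_mul, mul_assoc, hWU]
    module
  have key : ((U + 1) * (V + p • T - W * E) * U -
      V * (E * U * E + (z * p) • E - W * E) * (V + 1)) * T = p • (V * (1 - E) * (U + 1)) := by
    linear_combination (norm := skip) (U + 1) * hSUT - V * hPT + hVE * U * T + p • hUV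
    simp only [mul_add, add_mul, mul_sub, sub_mul, mul_one, one_mul, mul_assoc, smul_mul_assoc,
      mul_smul_comm, hWV, hWU]
    module
  have key' : V - T * U * T' = Q ^ 2 • ((U + 1) * (V + p • T - W * E) * U -
      V * (E * U * E + (z * p) • E - W * E) * (V + 1)) := by
    linear_combination (norm := skip) -(Q ^ 2 • (key * T')) +
      Q ^ 2 • (((U + 1) * (V + p • T - W * E) * U -
        V * (E * U * E + (z * p) • E - W * E) * (V + 1)) * hTT') -
      hTU * T' - V * hTT' - (Q * hp) • (V * (1 - E) * (U + 1) * T')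
    simp only [mul_add, add_mul, mul_sub, sub_mul, mul_one, one_mul, mul_assoc, smul_mul_assoc,
      mul_smul_comm, neg_mul, hWV, hWU]
    module
  rw [smul_sub] at key'
  linear_combination (norm := module) key'

end Abstract

theorem cst_smul {C A : Type*} [CommRing C] [Ring A] [Algebra C A] (r : C) (a : A) :
    cst (r • a) = r • cst a := by
  ext n
  by_cases h : n = 0 <;> simp [cst, HahnSeries.C_apply, h]

theorem cst_eq_ofPowerSeries {A : Type*} [Ring A] (a : A) :
    cst a = HahnSeries.ofPowerSeries ℤ A (PowerSeries.C a) := by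
  simp [cst]

/-- The variable `u⁻¹`. -/
noncomputable def uInv (A : Type*) [Ring A] : LaurentSeries A :=
  HahnSeries.ofPowerSeries ℤ A PowerSeries.X

theorem uInv_comm {A : Type*} [Ring A] (f : LaurentSeries A) : uInv A * f = f * uInv A := by
  rw [uInv, HahnSeries.ofPowerSeries_X]
  ext n
  obtain ⟨m, rfl⟩ : ∃ m, n = m + 1 := ⟨n - 1, by ring⟩
  rw [HahnSeries.coeff_single_mul_add, HahnSeries.coeff_mul_single_add]
  simp

theorem one_sub_mul_geomU {A : Type*} [Ring A] (a : A) :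
    (1 - uInv A * cst a) * (geomU a + 1) = 1 := by
  rw [uInv, cst_eq_ofPowerSeries, geomU, ← map_one (HahnSeries.ofPowerSeries ℤ A), ← map_mul,
    ← map_sub, ← map_add, ← map_mul]
  congr 1
  ext n
  rcases n with _ | _ | n <;>
    simp [sub_mul, mul_assoc, PowerSeries.coeff_succ_X_mul, PowerSeries.coeff_one, pow_succ']

theorem geomU_mul_one_sub {A : Type*} [Ring A] (a : A) :
    (geomU a + 1) * (1 - uInv A * cst a) = 1 := by
  rw [uInv_comm, uInv, cst_eq_ofPowerSeries, geomU, ← map_one (HahnSeries.ofPowerSeries ℤ A),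
    ← map_mul, ← map_sub, ← map_add, ← map_mul]
  congr 1
  ext n
  rcases n with _ | _ | n <;>
    simp [mul_sub, ← mul_assoc, PowerSeries.coeff_succ_mul_X, PowerSeries.coeff_one, pow_succ]

theorem geomU_eq_mul_left {A : Type*} [Ring A] (a : A) :
    geomU a = uInv A * cst a * (geomU a + 1) := by
  linear_combination (norm := noncomm_ring) one_sub_mul_geomU a

theorem geomU_eq_mul_right {A : Type*} [Ring A] (a : A) :
    geomU a = (geomU a + 1) * (uInv A * cst a) := by
  linear_combination (norm := noncomm_ring) geomU_mul_one_sub a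

theorem cst_mul_geomU2 {A : Type*} [Ring A] {e a : A} (h : e * a = e) :
    cst e * geomU2 a = invU2one A * cst e := by
  have hpow : ∀ n, e * a ^ n = e := fun n => by
    induction n with
    | zero => simp
    | succ n ih => rw [pow_succ, ← mul_assoc, ih, h]
  rw [cst_eq_ofPowerSeries, geomU2, invU2one, ← map_mul, ← map_mul]
  congr 1
  ext n
  simp only [PowerSeries.coeff_C_mul, PowerSeries.coeff_mul_C, PowerSeries.coeff_mk]
  split_ifs <;> simp [hpow]

theorem invU2one_add_one_mul {A : Type*} [Ring A] :
    (invU2one A + 1) * (1 - uInv A * uInv A) = 1 := by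
  rw [uInv, invU2one, ← map_one (HahnSeries.ofPowerSeries ℤ A), ← map_mul, ← map_sub, ← map_add,
    ← map_mul]
  congr 1
  ext n
  rcases n with _ | _ | n
  · simp
  · simp [mul_sub, ← mul_assoc, PowerSeries.coeff_succ_mul_X, PowerSeries.coeff_one]
  · have hn : (n + 1 + 1) % 2 = n % 2 := by omega
    rcases n with _ | n <;>
    simp [hn, mul_sub, ← mul_assoc, PowerSeries.coeff_succ_mul_X, PowerSeries.coeff_one]

theorem invU2one_comm {A : Type*} [Ring A] (f : LaurentSeries A) :
    invU2one A * f = f * invU2one A := by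
  have hW := invU2one_add_one_mul (A := A)
  have hx : ∀ g : LaurentSeries A, (uInv A * uInv A) * g = g * (uInv A * uInv A) := fun g => by
    rw [mul_assoc, uInv_comm g, ← mul_assoc, uInv_comm g, mul_assoc]
  have hW' : (1 - uInv A * uInv A) * (invU2one A + 1) = 1 := by
    rw [sub_mul, hx, one_mul, ← mul_one_sub, hW]
  have := resolvent_comm (M := f) hW' hW (sub_eq_zero.2 (hx f).symm)
  simpa [sub_eq_zero, eq_comm] using this

namespace AffBMW

variable {C : Type*} [CommRing C] {k : ℕ} {q z : Cˣ} {Z₀ : ℤ → C} {A : Type*} [Ring A]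
  [Algebra C A]

theorem Y_comm_T (B : AffBMW C k q z Z₀ A) (i j : ℕ) (h : j + 1 < k) (hij : i < j) :
    B.Y i * B.T j h = B.T j h * B.Y i := by
  induction i with
  | zero => rw [B.Y_zero, smul_mul_assoc, B.X_T j h hij, mul_smul_comm]
  | succ i ih =>
    have hT := B.braid_far i j (by omega) h (by omega)
    rw [B.Y_succ i (by omega), mul_assoc, hT, ← mul_assoc, mul_assoc (B.T i _), ih (by omega),
      ← mul_assoc, hT]
    simp only [mul_assoc]

theorem YTYT (B : AffBMW C k q z Z₀ A) (i : ℕ) (h : i + 1 < k) :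
    B.Y i * B.T i h * B.Y i * B.T i h = B.T i h * B.Y i * B.T i h * B.Y i := by
  induction i with
  | zero => simp only [B.Y_zero, smul_mul_assoc, mul_smul_comm, B.XTXT h]
  | succ i ih =>
    have hy := B.Y_comm_T i (i + 1) h (by omega)
    have ih := ih (by omega)
    have hb := B.braid i h
    rw [B.Y_succ i (by omega)]
    generalize B.Y i = y at *
    generalize B.T i _ = t at *
    generalize B.T (i + 1) _ = s at *
    calc t * y * t * s * (t * y * t) * s = t * y * (t * s * t) * y * t * s := by
          simp only [mul_assoc]
      _ = t * (y * s) * t * (s * y) * t * s := by rw [hb]; simp only [mul_assoc]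
      _ = t * s * (y * t * y) * (s * t * s) := by
          rw [show t * (y * s) * t * (s * y) = t * (s * y) * t * (y * s) by rw [hy]]
          simp only [mul_assoc]
      _ = t * s * (y * t * y * t) * s * t := by rw [← hb]; simp only [mul_assoc]
      _ = (t * s * t) * y * t * y * s * t := by rw [ih]; simp only [mul_assoc]
      _ = s * t * (s * y) * t * (y * s) * t := by rw [hb]; simp only [mul_assoc]
      _ = s * t * y * (s * t * s) * y * t := by
          rw [show s * t * (s * y) * t * (y * s) = s * t * (y * s) * t * (s * y) by rw [hy]]
          simp only [mul_assoc]
      _ = _ := by rw [← hb]; simp only [mul_assoc]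

theorem Y_comm_Y_succ (B : AffBMW C k q z Z₀ A) (i : ℕ) (h : i + 1 < k) :
    B.Y i * B.Y (i + 1) = B.Y (i + 1) * B.Y i := by
  rw [B.Y_succ i h]
  simpa only [mul_assoc] using B.YTYT i h

theorem T_mul_T (B : AffBMW C k q z Z₀ A) (i : ℕ) (h : i + 1 < k) :
    B.T i h * B.T i h = 1 + ((q : C) - ((q⁻¹ : Cˣ) : C)) • B.T i h -
      (((q : C) - ((q⁻¹ : Cˣ) : C)) * ((z⁻¹ : Cˣ) : C)) • B.E i h := by
  have hE := B.E_def i h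
  have hY := B.Yinv_Y i (by omega)
  have hT := B.Tinv_T i h
  have hTE := B.T_E i h
  rw [B.Y_succ i h] at hE
  have key := congrArg (fun x => B.Yinv i * (B.Tinv i h * x)) hE
  have hT' : ∀ x, B.Tinv i h * (B.T i h * x) = x := fun x => by rw [← mul_assoc, hT, one_mul]
  have hY' : ∀ x, B.Yinv i * (B.Y i * x) = x := fun x => by rw [← mul_assoc, hY, one_mul]
  simp only [mul_sub, mul_one, mul_smul_comm, mul_assoc, hT', hY', hY, hTE] at key
  linear_combination (norm := module) -key

theorem E_mul_E (B : AffBMW C k q z Z₀ A) (i : ℕ) (h : i + 1 < k) :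
    ((q : C) - ((q⁻¹ : Cˣ) : C)) • (B.E i h * B.E i h) =
      (((q : C) - ((q⁻¹ : Cˣ) : C)) + z - ((z⁻¹ : Cˣ) : C)) • B.E i h := by
  have hTT := congrArg (fun x => (z : C) • (B.E i h * x)) (B.T_mul_T i h)
  have hz := z.mul_inv
  have hET := B.E_T i h
  simp only [mul_sub, mul_add, mul_one, mul_smul_comm, ← mul_assoc, hET, smul_mul_assoc] at hTT
  linear_combination (norm := module) hTT - (hz * ((z⁻¹ : Cˣ) : C)) • B.E i h +
    (((q : C) - ((q⁻¹ : Cˣ) : C)) * hz) • B.E i h -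
    (((q : C) - ((q⁻¹ : Cˣ) : C)) * hz) • (B.E i h * B.E i h)

theorem T_mul_Y_succ (B : AffBMW C k q z Z₀ A) (i : ℕ) (h : i + 1 < k) :
    B.T i h * B.Y (i + 1) - B.Y i * B.T i h =
      ((q : C) - ((q⁻¹ : Cˣ) : C)) • ((1 - B.E i h) * B.Y (i + 1)) := by
  have hET := congrArg (· * (B.Y i * B.T i h)) (B.E_T i h)
  have hTT := congrArg (· * (B.Y i * B.T i h)) (B.T_mul_T i h)
  simp only [add_mul, sub_mul, one_mul, smul_mul_assoc, mul_assoc] at hET hTT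
  simp only [B.Y_succ i h, sub_mul, one_mul, mul_assoc]
  linear_combination (norm := module) hTT + ((q : C) - ((q⁻¹ : Cˣ) : C)) • hET

end AffBMW

/-- second intertwiner-like identity, affine case; (3.29) of the paper:
with `Q = q - q⁻¹` and `Uⱼ⁺ = Yⱼ/(u-Yⱼ)`, in formal Laurent series in `u⁻¹` over `W_k`
(0-indexed),
`(U_{i+1}⁺ + Tᵢ/Q - Eᵢ YᵢY_{i+1}/(u²-YᵢY_{i+1}))
   - Q² (Uᵢ⁺+1)(U_{i+1}⁺ + Tᵢ/Q - Eᵢ YᵢY_{i+1}/(u²-YᵢY_{i+1})) Uᵢ⁺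
 = (Tᵢ Uᵢ⁺ Tᵢ⁻¹ + Tᵢ/Q - Eᵢ YᵢY_{i+1}/(u²-YᵢY_{i+1}))
   - Q² U_{i+1}⁺ (Eᵢ Uᵢ⁺ Eᵢ + z Eᵢ/Q - Eᵢ YᵢY_{i+1}/(u²-YᵢY_{i+1})) (U_{i+1}⁺+1)`. -/
theorem affine_BMW_second_intertwiner
    (C : Type*) [CommRing C] (k : ℕ) (q z : Cˣ) (Z₀ : ℤ → C)
    (A : Type*) [Ring A] [Algebra C A]
    [Invertible ((q : C) - ((q⁻¹ : Cˣ) : C))]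
    (hk : 2 ≤ k)
    (B : AffBMW C k q z Z₀ A) :
    ∀ i (h : i + 1 < k),
      (geomU (B.Y (i + 1)) + ⅟((q : C) - ((q⁻¹ : Cˣ) : C)) • cst (B.T i h) -
            cst (B.E i h) * geomU2 (B.Y i * B.Y (i + 1))) -
        ((q : C) - ((q⁻¹ : Cˣ) : C)) ^ 2 •
          ((geomU (B.Y i) + 1) *
            (geomU (B.Y (i + 1)) + ⅟((q : C) - ((q⁻¹ : Cˣ) : C)) • cst (B.T i h) -
              cst (B.E i h) * geomU2 (B.Y i * B.Y (i + 1))) * geomU (B.Y i)) =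
      (cst (B.T i h) * geomU (B.Y i) * cst (B.Tinv i h) +
            ⅟((q : C) - ((q⁻¹ : Cˣ) : C)) • cst (B.T i h) -
            cst (B.E i h) * geomU2 (B.Y i * B.Y (i + 1))) -
        ((q : C) - ((q⁻¹ : Cˣ) : C)) ^ 2 •
          (geomU (B.Y (i + 1)) *
            (cst (B.E i h) * geomU (B.Y i) * cst (B.E i h) +
              ((z : C) * ⅟((q : C) - ((q⁻¹ : Cˣ) : C))) • cst (B.E i h) -
              cst (B.E i h) * geomU2 (B.Y i * B.Y (i + 1))) *
            (geomU (B.Y (i + 1)) + 1)) := by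
  intro i h
  have hE : ∀ x y : A, cst (x * y) = cst x * cst y := fun x y => map_mul HahnSeries.C x y
  have hS : ∀ x y : A, cst (x - y) = cst x - cst y := fun x y => map_sub HahnSeries.C x y
  have hA : ∀ x y : A, cst (x + y) = cst x + cst y := fun x y => map_add HahnSeries.C x y
  have h1 : cst (1 : A) = 1 := map_one HahnSeries.C
  have hx : ∀ f g : LaurentSeries A, f * (uInv A * g) = uInv A * (f * g) := fun f g => by
    rw [← mul_assoc, ← uInv_comm, mul_assoc]
  have hst : uInv A * cst (B.Y i) * (uInv A * cst (B.Y (i + 1))) =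
      uInv A * uInv A * cst (B.Y i * B.Y (i + 1)) := by
    simp only [mul_assoc, hx, hE]
  have hcomm : uInv A * cst (B.Y i) * (uInv A * cst (B.Y (i + 1))) =
      uInv A * cst (B.Y (i + 1)) * (uInv A * cst (B.Y i)) := by
    rw [hst, B.Y_comm_Y_succ i h, hE]
    simp only [mul_assoc, hx]
  obtain ⟨hUV, hl, hr⟩ := resolvent_mul_resolvent (one_sub_mul_geomU (B.Y i))
    (geomU_mul_one_sub (B.Y i)) (one_sub_mul_geomU (B.Y (i + 1)))
    (geomU_mul_one_sub (B.Y (i + 1))) hcomm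
  rw [hst] at hl hr
  have hTY : cst (B.T i h) * (uInv A * cst (B.Y i)) - uInv A * cst (B.Y (i + 1)) * cst (B.T i h) =
      -(((q : C) - ((q⁻¹ : Cˣ) : C)) • (uInv A * cst (B.Y (i + 1)) * (1 - cst (B.E i h)))) := by
    rw [hx, mul_assoc, mul_assoc, ← mul_sub, ← h1, ← hS, ← hE, ← hE, ← hE, ← hS, B.E_def,
      sub_sub_cancel_left, ← neg_smul, cst_smul, mul_smul_comm, neg_smul]
  have hTY' : cst (B.T i h) * (uInv A * cst (B.Y (i + 1))) - uInv A * cst (B.Y i) * cst (B.T i h) =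
      ((q : C) - ((q⁻¹ : Cˣ) : C)) • ((1 - cst (B.E i h)) * (uInv A * cst (B.Y (i + 1)))) := by
    rw [hx, hx, mul_assoc, ← mul_sub, ← h1, ← hS, ← hE, ← hE, ← hE, ← hS, B.T_mul_Y_succ,
      cst_smul, mul_smul_comm]
  rw [cst_mul_geomU2 (B.E_YY i h)]
  refine intertwiner_of_skein (Q := (q : C) - ((q⁻¹ : Cˣ) : C))
    (p := ⅟((q : C) - ((q⁻¹ : Cˣ) : C))) (z := z) (z' := ((z⁻¹ : Cˣ) : C))
    (T := cst (B.T i h)) (T' := cst (B.Tinv i h)) (E := cst (B.E i h)) (U := geomU (B.Y i))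
    (V := geomU (B.Y (i + 1))) (W := invU2one A)
    (invOf_mul_self _) ?_ ?_ ?_ z.mul_inv ?_ ?_ ?_ hUV ?_ ?_ invU2one_comm
  · rw [← hE, B.T_Tinv, h1]
  · rw [← hE, B.T_mul_T, hS, hA, h1, cst_smul, cst_smul]
  · rw [← hE, B.E_T, cst_smul]
  · rw [← hE, ← cst_smul, B.E_mul_E, cst_smul]
  · rw [resolvent_comm (one_sub_mul_geomU _) (geomU_mul_one_sub _) hTY, mul_neg, neg_mul,
      mul_smul_comm, smul_mul_assoc, ← mul_assoc, ← geomU_eq_mul_right]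
  · rw [resolvent_comm (one_sub_mul_geomU _) (geomU_mul_one_sub _) hTY', mul_smul_comm,
      smul_mul_assoc, mul_assoc, mul_assoc (1 - _), ← geomU_eq_mul_left, ← mul_assoc]
  · refine eq_mul_of_eq_mul_add invU2one_add_one_mul ?_
    nth_rewrite 1 [hl]
    rw [← mul_add, mul_assoc, mul_assoc, hx, hx, ← mul_assoc (cst _) (cst _), ← hE, B.E_YY]
    simp only [mul_assoc]
  · refine eq_mul_of_eq_mul_add invU2one_add_one_mul ?_
    nth_rewrite 1 [hr]
    rw [← add_mul, mul_assoc, mul_assoc, ← hE, B.YY_E]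
    simp only [mul_assoc, hx]
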